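/- arXiv:2004.13424 — 2 statements merged into one kernel-verified Lean document; each statement's English description precedes it below -/
import Mathlib

section
/- Let k ∈ ℝ and y ∈ ℝ³. The Helmholtz Green's function G(x) = exp(i k ‖x − y‖)/(4π ‖x − y‖) satisfies the Helmholtz equation −ΔG(x) − k² G(x) = 0 at every point x ∈ ℝ³ with x ≠ y, where Δ is the Euclidean Laplacian (the sum of the three pure second partial derivatives) applied to the complex-valued function G. -/
/-- The Euclidean Laplacian of a complex-valued function on `ℝ³`: the sum of the three
pure second partial derivatives (in the coordinate directions). -/
noncomputable def laplacian3 (f : EuclideanSpace ℝ (Fin 3) → ℂ)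
    (x : EuclideanSpace ℝ (Fin 3)) : ℂ :=
  ∑ i : Fin 3,
    fderiv ℝ (fun z => fderiv ℝ f z (EuclideanSpace.single i (1 : ℝ))) x
      (EuclideanSpace.single i (1 : ℝ))

/-- The Helmholtz Green's function centered at `y` with wavenumber `k`:
`G(x) = exp(i k ‖x − y‖) / (4π ‖x − y‖)`. -/
noncomputable def helmholtzGreen (k : ℝ) (y : EuclideanSpace ℝ (Fin 3)) :
    EuclideanSpace ℝ (Fin 3) → ℂ :=
  fun x => Complex.exp (Complex.I * (k : ℂ) * (‖x - y‖ : ℂ)) /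
    (4 * (Real.pi : ℂ) * (‖x - y‖ : ℂ))

/-- The Euclidean distance to `y` is differentiable away from `y`, with gradient
`(x - y) / ‖x - y‖`. -/
theorem hasFDerivAt_norm_sub_const {E : Type*} [NormedAddCommGroup E] [InnerProductSpace ℝ E]
    {x y : E} (hx : x ≠ y) :
    HasFDerivAt (fun z => ‖z - y‖) (‖x - y‖⁻¹ • innerSL ℝ (x - y)) x := by
  have hr : ‖x - y‖ ≠ 0 := norm_ne_zero_iff.mpr (sub_ne_zero.mpr hx)
  have h := (((hasFDerivAt_id (𝕜 := ℝ) x).sub_const y).norm_sq).sqrt (by simpa using hr)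
  simp only [id_eq, Real.sqrt_sq (norm_nonneg _)] at h
  refine h.congr_fderiv ?_
  ext v
  simp
  field_simp

/-- The chain rule for a radial function `z ↦ g ‖z - y‖`. -/
theorem HasDerivAt.hasFDerivAt_comp_norm_sub {E : Type*} [NormedAddCommGroup E]
    [InnerProductSpace ℝ E] {g : ℝ → ℂ} {g' : ℂ} {x y : E} (hx : x ≠ y)
    (hg : HasDerivAt g g' ‖x - y‖) :
    HasFDerivAt (fun z => g ‖z - y‖)
      ((‖x - y‖⁻¹ • innerSL ℝ (x - y)).smulRight g') x :=
  (hg.hasFDerivAt.comp x (hasFDerivAt_norm_sub_const hx)).congr_fderiv (by ext v; simp; ring)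

/-- The Laplacian of a radial function `g ‖z - y‖` on `ℝ³`, where `g' r = r h(r)`. -/
theorem laplacian3_comp_norm_sub {g h : ℝ → ℂ} {h' : ℂ} {x y : EuclideanSpace ℝ (Fin 3)}
    (hx : x ≠ y) (hg : ∀ r, 0 < r → HasDerivAt g (r * h r) r)
    (hh : HasDerivAt h h' ‖x - y‖) :
    laplacian3 (fun z => g ‖z - y‖) x = ‖x - y‖ * h' + 3 * h ‖x - y‖ := by
  have hpos : ∀ {z}, z ≠ y → 0 < ‖z - y‖ := fun hz => norm_pos_iff.mpr (sub_ne_zero.mpr hz)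
  have first (i : Fin 3) {z : EuclideanSpace ℝ (Fin 3)} (hz : z ≠ y) :
      fderiv ℝ (fun z => g ‖z - y‖) z (EuclideanSpace.single i (1 : ℝ)) =
        h ‖z - y‖ * ((z i - y i : ℝ) : ℂ) := by
    have hr : (‖z - y‖ : ℂ) ≠ 0 := by exact_mod_cast (hpos hz).ne'
    rw [((hg _ (hpos hz)).hasFDerivAt_comp_norm_sub hz).fderiv]
    simp [EuclideanSpace.inner_single_right]
    field_simp
  have second (i : Fin 3) :
      fderiv ℝ (fun z => fderiv ℝ (fun z => g ‖z - y‖) z (EuclideanSpace.single i (1 : ℝ))) x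
        (EuclideanSpace.single i (1 : ℝ)) =
        h ‖x - y‖ + (‖x - y‖ : ℂ)⁻¹ * h' * (((x - y) i ^ 2 : ℝ) : ℂ) := by
    have heq := (eventually_ne_nhds hx).mono fun z hz => first i hz
    have hcoord : HasFDerivAt (fun z : EuclideanSpace ℝ (Fin 3) => ((z i - y i : ℝ) : ℂ))
        (Complex.ofRealCLM.comp (EuclideanSpace.proj i)) x :=
      Complex.ofRealCLM.hasFDerivAt.comp x
        ((EuclideanSpace.proj (𝕜 := ℝ) i).hasFDerivAt.sub_const (y i))
    have hprod := (hh.hasFDerivAt_comp_norm_sub hx).mul hcoord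
    rw [(hprod.congr_of_eventuallyEq heq).fderiv]
    simp [EuclideanSpace.inner_single_right]
    ring
  have hsum : ∑ i, (((x - y) i ^ 2 : ℝ) : ℂ) = (‖x - y‖ : ℂ) ^ 2 := by
    exact_mod_cast (EuclideanSpace.real_norm_sq_eq (x - y)).symm
  have hr : (‖x - y‖ : ℂ) ≠ 0 := by exact_mod_cast (hpos hx).ne'
  simp only [laplacian3, second]
  rw [Finset.sum_add_distrib, ← Finset.mul_sum, hsum]
  simp
  field_simp
  ring

/-- The Helmholtz Green's function satisfies `−ΔG − k² G = 0` away from its singularity. -/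
theorem helmholtzGreen_satisfies_helmholtz (k : ℝ) (y : EuclideanSpace ℝ (Fin 3))
    (x : EuclideanSpace ℝ (Fin 3)) (hx : x ≠ y) :
    -laplacian3 (helmholtzGreen k y) x - (k : ℂ) ^ 2 * helmholtzGreen k y x = 0 := by
  have hr : 0 < ‖x - y‖ := norm_pos_iff.mpr (sub_ne_zero.mpr hx)
  have hexp (r : ℝ) : HasDerivAt (fun r : ℝ => Complex.exp (Complex.I * k * r))
      (Complex.exp (Complex.I * k * r) * (Complex.I * k)) r := by
    simpa using ((Complex.ofRealCLM.hasDerivAt (x := r)).const_mul (Complex.I * k)).cexp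
  have hπ : (Real.pi : ℂ) ≠ 0 := by exact_mod_cast Real.pi_ne_zero
  have hid (r : ℝ) : HasDerivAt (fun r : ℝ => (r : ℂ)) 1 r :=
    (hasDerivAt_id r).ofReal_comp
  have hg (r : ℝ) (hr : 0 < r) :
      HasDerivAt (fun r : ℝ => Complex.exp (Complex.I * k * r) / (4 * (Real.pi : ℂ) * r))
        (r * (Complex.exp (Complex.I * k * r) * (Complex.I * k * r - 1) /
          (4 * (Real.pi : ℂ) * (r : ℂ) ^ 3))) r := by
    have hr' : (r : ℂ) ≠ 0 := by exact_mod_cast hr.ne'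
    refine ((hexp r).div ((hid r).const_mul (4 * (Real.pi : ℂ)))
      (by simp [hr', hπ])).congr_deriv ?_
    field_simp
  have hr' : (‖x - y‖ : ℂ) ≠ 0 := by exact_mod_cast hr.ne'
  have hh := ((hexp ‖x - y‖).mul (((hid ‖x - y‖).const_mul (Complex.I * k)).sub_const 1)).div
    (((hid ‖x - y‖).pow 3).const_mul (4 * (Real.pi : ℂ))) (by simp [hr', hπ])
  have hlap := laplacian3_comp_norm_sub hx hg hh
  change laplacian3 (helmholtzGreen k y) x = _ at hlap
  rw [hlap]
  simp only [helmholtzGreen, Pi.mul_apply, Pi.pow_apply]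
  field_simp
  ring_nf
  simp only [Complex.I_sq]
  ring
end

section
/- Let k ∈ ℝ and y ∈ ℝ³, and let u_y(x) = exp(i k ‖x − y‖)/‖x − y‖ be the Helmholtz point source centered at y. Then u_y satisfies the Sommerfeld radiation condition ∂u_y/∂|x| − i k u_y = o(|x|⁻¹): the quantity ‖x‖ · (Du_y(x)[x/‖x‖] − i k u_y(x)) tends to 0 as ‖x‖ → ∞, where Du_y(x)[x/‖x‖] denotes the directional (Fréchet) derivative of u_y at x in the outward radial unit direction x/‖x‖. -/
/-- The Helmholtz point source centered at `y` with wavenumber `k`: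
`u_y(x) = exp(i k ‖x − y‖) / ‖x − y‖`. -/
noncomputable def helmholtzPointSource (k : ℝ) (y : EuclideanSpace ℝ (Fin 3)) :
    EuclideanSpace ℝ (Fin 3) → ℂ :=
  fun x => Complex.exp (Complex.I * (k : ℂ) * (‖x - y‖ : ℂ)) / (‖x - y‖ : ℂ)

theorem hasFDerivAt_norm_of_ne_zero {E : Type*} [NormedAddCommGroup E] [InnerProductSpace ℝ E]
    {x : E} (hx : x ≠ 0) :
    HasFDerivAt (fun z : E => ‖z‖) (‖x‖⁻¹ • innerSL ℝ x) x := by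
  have h := (hasStrictFDerivAt_norm_sq x).hasFDerivAt.sqrt (by positivity)
  simp only [Real.sqrt_sq (norm_nonneg _)] at h
  convert h using 1
  ext v
  simp
  ring

theorem hasDerivAt_exp_mul_div (k : ℝ) {r : ℝ} (hr : r ≠ 0) :
    HasDerivAt (fun t : ℝ => Complex.exp (Complex.I * (k : ℂ) * (t : ℂ)) / (t : ℂ))
      ((Complex.I * k - (r : ℂ)⁻¹) * (Complex.exp (Complex.I * k * r) / r)) r := by
  have hr' : (r : ℂ) ≠ 0 := by exact_mod_cast hr
  have hid : HasDerivAt (fun t : ℝ => (t : ℂ)) 1 r := Complex.ofRealCLM.hasDerivAt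
  refine (((hid.const_mul (Complex.I * (k : ℂ))).cexp).div hid hr').congr_deriv ?_
  field_simp

theorem fderiv_helmholtzPointSource_apply (k : ℝ) {x y : EuclideanSpace ℝ (Fin 3)} (hxy : x ≠ y)
    (v : EuclideanSpace ℝ (Fin 3)) :
    fderiv ℝ (helmholtzPointSource k y) x v =
      ((inner ℝ (x - y) v / ‖x - y‖ : ℝ) : ℂ) *
        ((Complex.I * k - (‖x - y‖ : ℂ)⁻¹) * helmholtzPointSource k y x) := by
  have hnorm := (hasFDerivAt_norm_of_ne_zero (sub_ne_zero.2 hxy)).comp x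
    ((hasFDerivAt_id x).sub_const y)
  have h := (hasDerivAt_exp_mul_div k
    (norm_ne_zero_iff.2 (sub_ne_zero.2 hxy))).hasFDerivAt.comp x hnorm
  have h' : HasFDerivAt (helmholtzPointSource k y) _ x := h
  rw [h'.fderiv]
  simp [helmholtzPointSource, inner_sub_left]
  ring

theorem norm_helmholtzPointSource (k : ℝ) (x y : EuclideanSpace ℝ (Fin 3)) :
    ‖helmholtzPointSource k y x‖ = ‖x - y‖⁻¹ := by
  have h : Complex.I * (k : ℂ) * (‖x - y‖ : ℂ) = ((k * ‖x - y‖ : ℝ) : ℂ) * Complex.I := by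
    push_cast
    ring
  rw [helmholtzPointSource, h, norm_div, Complex.norm_exp_ofReal_mul_I]
  simp

theorem abs_inner_sub_smul_sub_norm_le {E : Type*} [NormedAddCommGroup E] [InnerProductSpace ℝ E]
    (x y : E) (hx : x ≠ 0) :
    |inner ℝ (x - y) (‖x‖⁻¹ • x) - ‖x - y‖| ≤ 2 * ‖y‖ := by
  have hx' : ‖x‖ ≠ 0 := norm_ne_zero_iff.2 hx
  have hunit : ‖‖x‖⁻¹ • x‖ = 1 := by
    rw [norm_smul, norm_inv, norm_norm, inv_mul_cancel₀ (norm_ne_zero_iff.2 hx)]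
  have hxx : inner ℝ x (‖x‖⁻¹ • x) = ‖x‖ := by
    rw [inner_smul_right, real_inner_self_eq_norm_sq]
    field_simp
  have hy := abs_real_inner_le_norm y (‖x‖⁻¹ • x)
  have hxy := abs_norm_sub_norm_le x (x - y)
  rw [hunit, mul_one] at hy
  rw [sub_sub_cancel] at hxy
  rw [inner_sub_left, hxx]
  rw [abs_le] at *
  constructor <;> linarith [hy.1, hy.2, hxy.1, hxy.2]

theorem norm_fderiv_helmholtzPointSource_sub_le (k : ℝ) {x y : EuclideanSpace ℝ (Fin 3)}
    (hx : x ≠ 0) (hxy : x ≠ y) :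
    ‖fderiv ℝ (helmholtzPointSource k y) x (‖x‖⁻¹ • x) -
        Complex.I * (k : ℂ) * helmholtzPointSource k y x‖ ≤
      (2 * |k| * ‖y‖ + 1) / ‖x - y‖ ^ 2 := by
  have hr : 0 < ‖x - y‖ := norm_pos_iff.2 (sub_ne_zero.2 hxy)
  have hunit : ‖‖x‖⁻¹ • x‖ = 1 := by
    rw [norm_smul, norm_inv, norm_norm, inv_mul_cancel₀ (norm_ne_zero_iff.2 hx)]
  have hinner := abs_inner_sub_smul_sub_norm_le x y hx
  have habs := abs_real_inner_le_norm (x - y) (‖x‖⁻¹ • x)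
  rw [hunit, mul_one] at habs
  rw [fderiv_helmholtzPointSource_apply k hxy]
  set p : ℝ := inner ℝ (x - y) (‖x‖⁻¹ • x)
  set r := ‖x - y‖
  have hc : |p / r - 1| ≤ 2 * ‖y‖ / r := by
    rw [div_sub_one hr.ne', abs_div, abs_of_pos hr]
    gcongr
  have hc' : |p / r| ≤ 1 := by
    rw [abs_div, abs_of_pos hr]
    exact div_le_one_of_le₀ habs hr.le
  calc
    _ = ‖(Complex.I * k * ((p / r - 1 : ℝ) : ℂ) - ((p / r : ℝ) : ℂ) * ((r⁻¹ : ℝ) : ℂ)) *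
          helmholtzPointSource k y x‖ := by
      congr 1
      push_cast
      ring
    _ ≤ (|k| * |p / r - 1| + |p / r| * r⁻¹) * r⁻¹ := by
      rw [norm_mul, norm_helmholtzPointSource]
      gcongr
      refine (norm_sub_le _ _).trans_eq ?_
      simp only [norm_mul, Complex.norm_I, Complex.norm_real, Real.norm_eq_abs, one_mul,
        abs_inv, abs_of_pos hr]
    _ ≤ (|k| * (2 * ‖y‖ / r) + 1 * r⁻¹) * r⁻¹ := by gcongr
    _ = (2 * |k| * ‖y‖ + 1) / r ^ 2 := by field_simp

/-- The Helmholtz point source satisfies the Sommerfeld radiation condition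
`∂u/∂|x| − i k u = o(|x|⁻¹)`: the quantity `‖x‖ (Du(x)[x/‖x‖] − i k u(x))` tends to `0`
as `‖x‖ → ∞` (along the cobounded filter on `ℝ³`). -/
theorem helmholtzPointSource_sommerfeld (k : ℝ) (y : EuclideanSpace ℝ (Fin 3)) :
    Filter.Tendsto
      (fun x : EuclideanSpace ℝ (Fin 3) =>
        (‖x‖ : ℂ) *
          (fderiv ℝ (helmholtzPointSource k y) x (‖x‖⁻¹ • x) -
            Complex.I * (k : ℂ) * helmholtzPointSource k y x))
      (Bornology.cobounded (EuclideanSpace ℝ (Fin 3))) (nhds 0) := by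
  have hlim : Filter.Tendsto
      (fun x : EuclideanSpace ℝ (Fin 3) => 4 * (2 * |k| * ‖y‖ + 1) * ‖x‖⁻¹)
      (Bornology.cobounded (EuclideanSpace ℝ (Fin 3))) (nhds 0) := by
    simpa using (tendsto_norm_cobounded_atTop.inv_tendsto_atTop).const_mul
      (4 * (2 * |k| * ‖y‖ + 1))
  refine squeeze_zero_norm' ?_ hlim
  filter_upwards [tendsto_norm_cobounded_atTop.eventually_gt_atTop (2 * ‖y‖)] with x hx
  have hx0 : 0 < ‖x‖ := by linarith [norm_nonneg y]
  have hr : ‖x‖ / 2 ≤ ‖x - y‖ := by linarith [norm_sub_norm_le x y]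
  have hxy : x ≠ y := by
    rintro rfl
    linarith
  rw [norm_mul, Complex.norm_real, norm_norm]
  calc
    _ ≤ ‖x‖ * ((2 * |k| * ‖y‖ + 1) / ‖x - y‖ ^ 2) := by
      gcongr
      exact norm_fderiv_helmholtzPointSource_sub_le k (norm_pos_iff.1 hx0) hxy
    _ ≤ ‖x‖ * ((2 * |k| * ‖y‖ + 1) / (‖x‖ / 2) ^ 2) := by gcongr
    _ = 4 * (2 * |k| * ‖y‖ + 1) * ‖x‖⁻¹ := by field_simp; norm_num
end
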